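/- arXiv:1504.08307 — 2 statements merged into one kernel-verified Lean document; each statement's English description precedes it below -/
import Mathlib

section
/- Let n ≥ 4 and 2 ≤ i ≤ n−2 be integers. Then for all indices p, q with 1 ≤ p ≤ n−i < q ≤ n, the linear polynomial λ_p − λ_q does NOT divide D_{n,i} in ℚ[λ_1,…,λ_n]; equivalently, the polynomial obtained from D_{n,i} by substituting λ_p for λ_q is not the zero polynomial. -/
open MvPolynomial Finset

/-- The `n × n` matrix `M_{n,i}` over `ℚ[λ_1,…,λ_n]` (1-indexed in the paper,
0-indexed here): rows `0,…,n−3` contain the powers `λⱼ^{n−2−k}`, row `n−2`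
contains the indicator of `j ≤ n−i`, row `n−1` the indicator of `j > n−i`. -/
noncomputable def kingMatrix (n i : ℕ) : Matrix (Fin n) (Fin n) (MvPolynomial (Fin n) ℚ) :=
  fun k j =>
    if (k : ℕ) < n - 2 then MvPolynomial.X j ^ (n - 2 - (k : ℕ))
    else if (k : ℕ) = n - 2 then (if (j : ℕ) < n - i then 1 else 0)
    else (if (j : ℕ) < n - i then 0 else 1)

/-- The Goldie rank (character) polynomial `D_{n,i} = det M_{n,i}` of the
discrete series `X_λ(i)` of `SU(n,1)`, up to a nonzero constant. -/
noncomputable def kingPoly (n i : ℕ) : MvPolynomial (Fin n) ℚ := (kingMatrix n i).det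

/-- For `n ≥ 4` and `2 ≤ i ≤ n−2`, `λ_p − λ_q` does not divide `D_{n,i}` in
`ℚ[λ_1,…,λ_n]` whenever `p ≤ n−i < q` (1-indexed; here 0-indexed). -/
theorem kingPoly_not_divisible (n i : ℕ) (hn : 4 ≤ n) (hi₁ : 2 ≤ i)
    (hi₂ : i ≤ n - 2) (p q : Fin n)
    (hp : (p : ℕ) < n - i) (hq : n - i ≤ (q : ℕ)) :
    ¬ (MvPolynomial.X p - MvPolynomial.X q) ∣ kingPoly n i := by
  intro hdvd
  obtain ⟨m, rfl⟩ : ∃ m, n = m + 2 := ⟨n - 2, by omega⟩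
  have hpq : p ≠ q := by rintro rfl; omega
  -- evaluation point: distinct values, except that the values at `p` and `q` agree
  let x : Fin (m + 2) → ℚ := fun j => if j = q then ((p : ℕ) : ℚ) else ((j : ℕ) : ℚ)
  have hxp : x p = ((p : ℕ) : ℚ) := by simp [x]
  have hxq : x q = ((p : ℕ) : ℚ) := by simp [x]
  have h0 : MvPolynomial.eval x (kingPoly (m + 2) i) = 0 := by
    obtain ⟨c, hc⟩ := hdvd
    rw [hc]
    simp [hxp, hxq]
  rw [kingPoly, RingHom.map_det] at h0
  obtain ⟨v, hv, hvM⟩ := Matrix.exists_vecMul_eq_zero_iff.mpr h0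
  let Q : Polynomial ℚ :=
    ∑ k : Fin m, Polynomial.C (v k.castSucc.castSucc) * Polynomial.X ^ (m - (k : ℕ))
  have key : ∀ j, Q.eval (x j) + (if (j : ℕ) < m + 2 - i then v (Fin.last m).castSucc
      else v (Fin.last (m + 1))) = 0 := by
    intro j
    have h := congrFun hvM j
    simp only [Matrix.vecMul, dotProduct, Fin.sum_univ_castSucc, RingHom.mapMatrix_apply,
      Matrix.map_apply, kingMatrix, Pi.zero_apply] at h
    rw [← h, add_assoc]
    congr 1
    · simp only [Q, Polynomial.eval_finset_sum]
      refine Finset.sum_congr rfl fun k _ => ?_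
      simp [k.2]
    · split_ifs <;> simp_all
  have hab : v (Fin.last m).castSucc = v (Fin.last (m + 1)) := by
    have h1 := key p
    have h2 := key q
    rw [if_pos hp, hxp] at h1
    rw [if_neg (by omega), hxq] at h2
    linarith
  let P : Polynomial ℚ := Q + Polynomial.C (v (Fin.last m).castSucc)
  have hPev : ∀ j, P.eval (x j) = 0 := by
    intro j
    have h := key j
    rw [← hab, ite_self] at h
    simpa [P] using h
  have hdeg : P.natDegree ≤ m := by
    refine Polynomial.natDegree_add_le_of_degree_le ?_ (by simp)
    refine Polynomial.natDegree_sum_le_of_forall_le _ _ fun k _ => ?_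
    exact (Polynomial.natDegree_C_mul_X_pow_le _ _).trans (by omega)
  have hP : P = 0 := by
    refine Polynomial.eq_zero_of_natDegree_lt_card_of_eval_eq_zero' P
      ((Finset.univ.erase q).image x) ?_ ?_
    · intro y hy
      obtain ⟨j, -, rfl⟩ := Finset.mem_image.mp hy
      exact hPev j
    · rw [Finset.card_image_of_injOn]
      · simp; omega
      · intro a ha b hb hab
        have ha' : a ≠ q := by simpa using ha
        have hb' : b ≠ q := by simpa using hb
        simp only [x, if_neg ha', if_neg hb'] at hab
        exact Fin.ext (by exact_mod_cast hab)
  have hQ0 : Q.coeff 0 = 0 := by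
    simp only [Q, Polynomial.finset_sum_coeff, Polynomial.coeff_C_mul, Polynomial.coeff_X_pow]
    refine Finset.sum_eq_zero fun k _ => ?_
    rw [if_neg (by omega), mul_zero]
  have ha : v (Fin.last m).castSucc = 0 := by
    have h : P.coeff 0 = 0 := by rw [hP]; simp
    simpa [P, hQ0] using h
  have hQ : Q = 0 := by simpa [P, ha] using hP
  have hk : ∀ k : Fin m, v k.castSucc.castSucc = 0 := by
    intro k
    have h : Q.coeff (m - (k : ℕ)) = 0 := by rw [hQ]; simp
    simp only [Q, Polynomial.finset_sum_coeff, Polynomial.coeff_C_mul,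
      Polynomial.coeff_X_pow] at h
    rw [Finset.sum_eq_single k] at h
    · simpa using h
    · intro b _ hb
      have : (b : ℕ) ≠ k := fun h => hb (Fin.ext h)
      rw [if_neg (by omega), mul_zero]
    · simp
  apply hv
  funext j
  refine Fin.lastCases ?_ (fun j => ?_) j
  · simpa [← hab] using ha
  · refine Fin.lastCases ?_ (fun k => ?_) j
    · simpa using ha
    · simpa using hk k
end

section
/- Let n ≥ 4 and 2 ≤ i ≤ n−2 be integers. In ℚ[λ_1,…,λ_n] set V = ∏_{1 ≤ p < q ≤ n}(λ_p − λ_q), and R = ∏_{1 ≤ p < q ≤ n−i}(λ_p − λ_q) · ∏_{n−i+1 ≤ r < s ≤ n}(λ_r − λ_s). Then R is a greatest common divisor of V and D_{n,i}: R divides V, R divides D_{n,i}, and every polynomial dividing both V and D_{n,i} divides R. -/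
open MvPolynomial Finset

/-- The full Vandermonde polynomial `V = ∏_{p<q}(λ_p−λ_q)`, which is (up to a
nonzero constant) the index polynomial of the discrete series. -/
noncomputable def vandermonde (n : ℕ) : MvPolynomial (Fin n) ℚ :=
  ∏ pq ∈ Finset.univ.filter (fun pq : Fin n × Fin n => pq.1 < pq.2),
    (MvPolynomial.X pq.1 - MvPolynomial.X pq.2)

/-- The product `R` of the linear factors corresponding to the roots generated
by the τ-invariant: `R = ∏_{p<q≤n−i}(λ_p−λ_q) · ∏_{n−i<r<s}(λ_r−λ_s)`
(1-indexed; here 0-indexed). -/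
noncomputable def tauFactor (n i : ℕ) : MvPolynomial (Fin n) ℚ :=
  (∏ pq ∈ Finset.univ.filter
      (fun pq : Fin n × Fin n => pq.1 < pq.2 ∧ (pq.2 : ℕ) < n - i),
    (MvPolynomial.X pq.1 - MvPolynomial.X pq.2)) *
  ∏ rs ∈ Finset.univ.filter
      (fun rs : Fin n × Fin n => n - i ≤ (rs.1 : ℕ) ∧ rs.1 < rs.2),
    (MvPolynomial.X rs.1 - MvPolynomial.X rs.2)

theorem king_sub_ne_zero {n : ℕ} {p q : Fin n} (h : p ≠ q) :
    (X p - X q : MvPolynomial (Fin n) ℚ) ≠ 0 := by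
  intro h0
  exact h (X_injective (sub_eq_zero.mp h0))

theorem king_irreducible {n : ℕ} {p q : Fin n} (h : p ≠ q) :
    Irreducible (X p - X q : MvPolynomial (Fin n) ℚ) := by
  apply irreducible_of_totalDegree_eq_one
  · exact ((isHomogeneous_X ℚ p).sub (isHomogeneous_X ℚ q)).totalDegree (king_sub_ne_zero h)
  · intro x hx
    have h1 := hx (Finsupp.single p 1)
    rw [coeff_sub, coeff_X, coeff_single_X] at h1
    simp [h.symm] at h1
    exact isUnit_iff_ne_zero.mpr h1

theorem king_isRelPrime {n : ℕ} {a b c d : Fin n} (hab : a < b) (hcd : c < d)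
    (hne : (a, b) ≠ (c, d)) :
    IsRelPrime (X a - X b : MvPolynomial (Fin n) ℚ) (X c - X d) := by
  rw [(king_irreducible hab.ne).isRelPrime_iff_not_dvd]
  rintro ⟨g, hg⟩
  have key : ∀ e : Fin n, e ≠ a → e ≠ b → e = c ∨ e = d → False := by
    intro e hea heb he
    have h1 := congrArg (eval (fun j => if j = e then (1 : ℚ) else 0)) hg
    rcases he with rfl | rfl
    · simp [hea.symm, heb.symm, hcd.ne'] at h1
    · simp [hea.symm, heb.symm, hcd.ne] at h1
  have hc : c = a ∨ c = b := by
    by_contra! h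
    exact key c h.1 h.2 (Or.inl rfl)
  have hd : d = a ∨ d = b := by
    by_contra! h
    exact key d h.1 h.2 (Or.inr rfl)
  rcases hc with rfl | rfl <;> rcases hd with rfl | rfl
  · exact lt_irrefl _ hcd
  · exact hne rfl
  · exact lt_asymm hab hcd
  · exact lt_irrefl _ hcd

theorem king_dvd {n i : ℕ} {p q : Fin n} (hpq : p ≠ q)
    (h : (p : ℕ) < n - i ↔ (q : ℕ) < n - i) :
    (X p - X q : MvPolynomial (Fin n) ℚ) ∣ kingPoly n i := by
  rw [← Ideal.mem_span_singleton, ← Ideal.Quotient.eq_zero_iff_mem, kingPoly, RingHom.map_det]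
  have hX : Ideal.Quotient.mk (Ideal.span {(X p - X q : MvPolynomial (Fin n) ℚ)}) (X p)
      = Ideal.Quotient.mk _ (X q) := by
    rw [Ideal.Quotient.eq]
    exact Ideal.mem_span_singleton_self _
  apply Matrix.det_zero_of_column_eq hpq
  intro k
  simp only [RingHom.mapMatrix_apply, Matrix.map_apply, kingMatrix, h]
  split_ifs <;> simp [hX]

theorem king_not_dvd {n i : ℕ} (hn : 2 ≤ n) {p q : Fin n} (hp : (p : ℕ) < n - i)
    (hq : n - i ≤ (q : ℕ)) :
    ¬ (X p - X q : MvPolynomial (Fin n) ℚ) ∣ kingPoly n i := by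
  obtain ⟨m, rfl⟩ : ∃ m, n = m + 2 := ⟨n - 2, by omega⟩
  rintro ⟨g, hg⟩
  have hpq : p ≠ q := by
    rintro rfl
    omega
  set x : Fin (m + 2) → ℚ := fun j => if j = q then (p : ℕ) else (j : ℕ) with hx
  have h0 := congrArg (eval x) hg
  have hxp : x p = x q := by simp [hx]
  rw [map_mul, map_sub, eval_X, eval_X, hxp, sub_self, zero_mul, kingPoly, RingHom.map_det] at h0
  obtain ⟨v, hv0, hv⟩ := Matrix.exists_vecMul_eq_zero_iff.mpr h0
  have hcol : ∀ j : Fin (m + 2), (∑ k : Fin m, v k.castSucc.castSucc * x j ^ (m - (k : ℕ)))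
      + v (Fin.last m).castSucc * (if (j : ℕ) < m + 2 - i then 1 else 0)
      + v (Fin.last (m + 1)) * (if (j : ℕ) < m + 2 - i then 0 else 1) = 0 := by
    intro j
    have h1 := congrFun hv j
    simp only [Matrix.vecMul, dotProduct, RingHom.mapMatrix_apply, Matrix.map_apply,
      kingMatrix, Pi.zero_apply] at h1
    rw [Fin.sum_univ_castSucc, Fin.sum_univ_castSucc] at h1
    simpa [apply_ite (eval x)] using h1
  have hab : v (Fin.last m).castSucc = v (Fin.last (m + 1)) := by
    have h1 := hcol p
    have h2 := hcol q
    rw [hxp] at h1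
    rw [if_pos hp, if_pos hp] at h1
    rw [if_neg (by omega), if_neg (by omega)] at h2
    linarith
  set f : Polynomial ℚ := (∑ k : Fin m, Polynomial.C (v k.castSucc.castSucc)
      * Polynomial.X ^ (m - (k : ℕ))) + Polynomial.C (v (Fin.last (m + 1))) with hf
  have hfeval : ∀ j, f.eval (x j) = 0 := by
    intro j
    have h1 := hcol j
    rw [hab] at h1
    simp only [hf, Polynomial.eval_add, Polynomial.eval_finset_sum, Polynomial.eval_mul,
      Polynomial.eval_C, Polynomial.eval_pow, Polynomial.eval_X]
    split_ifs at h1 <;> linarith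
  have hdeg : f.natDegree ≤ m := by
    apply Polynomial.natDegree_add_le_of_degree_le
    · apply Polynomial.natDegree_sum_le_of_forall_le
      intro k _
      exact (Polynomial.natDegree_C_mul_X_pow_le _ _).trans (Nat.sub_le _ _)
    · simp
  have hf0 : f = 0 := by
    apply Polynomial.eq_zero_of_natDegree_lt_card_of_eval_eq_zero' f
      ((Finset.univ.erase q).image x)
    · intro r hr
      obtain ⟨j, -, rfl⟩ := Finset.mem_image.mp hr
      exact hfeval j
    · rw [Finset.card_image_of_injOn, Finset.card_erase_of_mem (Finset.mem_univ _)]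
      · simp
        omega
      · intro a ha b hb hh
        have ha' : a ≠ q := by simpa using ha
        have hb' : b ≠ q := by simpa using hb
        simp only [hx, if_neg ha', if_neg hb'] at hh
        exact Fin.ext (by exact_mod_cast hh)
  have hcoef : ∀ k : Fin m, v k.castSucc.castSucc = 0 := by
    intro k
    have h1 := congrArg (fun g => Polynomial.coeff g (m - (k : ℕ))) hf0
    have hk : m - (k : ℕ) ≠ 0 := by omega
    simp only [hf, Polynomial.coeff_add, Polynomial.finset_sum_coeff, Polynomial.coeff_C_mul,
      Polynomial.coeff_X_pow, Polynomial.coeff_C, if_neg hk, Polynomial.coeff_zero, add_zero] at h1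
    rw [Finset.sum_eq_single k] at h1
    · simpa using h1
    · intro l _ hl
      rw [if_neg, mul_zero]
      intro h2
      apply hl
      apply Fin.ext
      omega
    · simp
  have hlast : v (Fin.last (m + 1)) = 0 := by
    have h1 := hf0
    simp only [hf, hcoef, map_zero, zero_mul, Finset.sum_const_zero, zero_add] at h1
    simpa using h1
  apply hv0
  funext k
  refine Fin.lastCases hlast (fun k => ?_) k
  refine Fin.lastCases (hab.trans hlast) (fun k => ?_) k
  exact hcoef k

theorem king_tau_eq (n i : ℕ) : tauFactor n i =
    ∏ pq ∈ Finset.univ.filter (fun pq : Fin n × Fin n => pq.1 < pq.2 ∧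
      ((pq.1 : ℕ) < n - i ↔ (pq.2 : ℕ) < n - i)),
    (MvPolynomial.X pq.1 - MvPolynomial.X pq.2) := by
  rw [tauFactor, ← Finset.prod_union]
  · congr 1
    ext ⟨a, b⟩
    simp only [Finset.mem_union, Finset.mem_filter, Finset.mem_univ, true_and, Fin.lt_def]
    omega
  · rw [Finset.disjoint_left]
    rintro ⟨a, b⟩
    simp only [Finset.mem_filter, Finset.mem_univ, true_and, Fin.lt_def]
    omega

theorem king_vandermonde_eq (n i : ℕ) : vandermonde n = tauFactor n i *
    ∏ pq ∈ Finset.univ.filter (fun pq : Fin n × Fin n => (pq.1 : ℕ) < n - i ∧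
      n - i ≤ (pq.2 : ℕ)),
    (MvPolynomial.X pq.1 - MvPolynomial.X pq.2) := by
  rw [king_tau_eq, vandermonde, ← Finset.prod_union]
  · congr 1
    ext ⟨a, b⟩
    simp only [Finset.mem_union, Finset.mem_filter, Finset.mem_univ, true_and, Fin.lt_def]
    omega
  · rw [Finset.disjoint_left]
    rintro ⟨a, b⟩
    simp only [Finset.mem_filter, Finset.mem_univ, true_and, Fin.lt_def]
    omega

/-- For `n ≥ 4` and `2 ≤ i ≤ n−2`, `R` is a greatest common divisor of the
index polynomial `V` and the Goldie rank polynomial `D_{n,i}`. -/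
theorem kingPoly_gcd (n i : ℕ) (hn : 4 ≤ n) (hi₁ : 2 ≤ i) (hi₂ : i ≤ n - 2) :
    tauFactor n i ∣ vandermonde n ∧
    tauFactor n i ∣ kingPoly n i ∧
    ∀ r : MvPolynomial (Fin n) ℚ,
      r ∣ vandermonde n → r ∣ kingPoly n i → r ∣ tauFactor n i := by
  refine ⟨⟨_, king_vandermonde_eq n i⟩, ?_, ?_⟩
  · rw [king_tau_eq]
    apply Finset.prod_dvd_of_isRelPrime
    · rintro ⟨a, b⟩ hab ⟨c, d⟩ hcd hne
      simp only [Finset.coe_filter, Finset.mem_univ, true_and, Set.mem_setOf_eq] at hab hcd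
      exact king_isRelPrime hab.1 hcd.1 hne
    · rintro ⟨a, b⟩ hab
      simp only [Finset.mem_filter, Finset.mem_univ, true_and] at hab
      exact king_dvd hab.1.ne hab.2
  · intro r hV hD
    rw [king_vandermonde_eq n i] at hV
    refine IsRelPrime.dvd_of_dvd_mul_right (IsRelPrime.prod_right ?_) hV
    rintro ⟨a, b⟩ hab
    simp only [Finset.mem_filter, Finset.mem_univ, true_and] at hab
    have hne : a ≠ b := by
      rintro rfl
      omega
    refine IsRelPrime.symm ((king_irreducible hne).isRelPrime_iff_not_dvd.mpr fun h => ?_)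
    exact king_not_dvd (by omega) hab.1 hab.2 (h.trans hD)
end
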